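/- Let G be an unbounded quasidisk with ∞ ∈ ∂G and ρ an Ahlfors quasiconformal reflection for G (a bi-Lipschitz homeomorphism of ℂ fixing ∂G pointwise and interchanging G and ℂ \ closure(G)). Then there exists a bounded, self-adjoint, bijective linear operator R on B₂(G) such that the system {R K_{B₂(G)}(·, ρ(ξ))}_{ξ ∈ ℂ \ closure(G)} is orthosimilar with respect to area measure: every f ∈ B₂(G) can be represented as f(z) = ∫_{ℂ \ closure(G)} (f, R K_{B₂(G)}(·, ρ(ξ)))_{B₂(G)} · (R K_{B₂(G)}(·, ρ(ξ)))(z) dA(ξ) for z ∈ G. -/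

import Mathlib

open MeasureTheory Complex

/-- Membership in the Bergman space `B₂(G)`: holomorphic and area-square-integrable on `G`. -/
def MemB2 (G : Set ℂ) (f : ℂ → ℂ) : Prop :=
  DifferentiableOn ℂ f G ∧ IntegrableOn (fun z => ‖f z‖ ^ 2) G volume

/-- The Bergman inner product `(f,g) = ∫_G f conj g dA` (linear in the first argument). -/
noncomputable def bInner (G : Set ℂ) (f g : ℂ → ℂ) : ℂ :=
  ∫ z in G, f z * (starRingEnd ℂ) (g z) ∂volume

/-- A (bounded) quasidisk: a bounded simply connected Jordan-type domain such that any two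
boundary points are joined by a boundary arc of diameter at most `C` times their distance. -/
def IsQuasidisk (D : Set ℂ) : Prop :=
  IsOpen D ∧ IsConnected D ∧ Bornology.IsBounded D ∧ SimplyConnectedSpace D ∧
  ∃ C > 0, ∀ z₁ ∈ frontier D, ∀ z₂ ∈ frontier D,
    ∃ l : Set ℂ, l ⊆ frontier D ∧ z₁ ∈ l ∧ z₂ ∈ l ∧ IsConnected l ∧
      Metric.diam l ≤ C * dist z₁ z₂

/-- An unbounded quasidisk with `∞ ∈ ∂G`: an unbounded domain sent to a (bounded) quasidisk
by a Möbius inversion about a point outside its closure. -/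
def IsUnboundedQuasidisk (G : Set ℂ) : Prop :=
  IsOpen G ∧ IsConnected G ∧ ¬ Bornology.IsBounded G ∧
  ∃ a : ℂ, a ∉ closure G ∧ IsQuasidisk ((fun z => (z - a)⁻¹) '' G)

/-- An Ahlfors quasiconformal reflection for `G`: a bi-Lipschitz homeomorphism of `ℂ`
fixing `∂G` pointwise and interchanging `G` and `ℂ \ closure G`. -/
def IsAhlforsReflection (G : Set ℂ) (ρ : ℂ → ℂ) : Prop :=
  Function.Bijective ρ ∧
  (∃ C₁ > (0:ℝ), ∃ C₂ > (0:ℝ), ∀ z₁ z₂ : ℂ,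
    C₁ * ‖z₁ - z₂‖ ≤ ‖ρ z₁ - ρ z₂‖ ∧ ‖ρ z₁ - ρ z₂‖ ≤ C₂ * ‖z₁ - z₂‖) ∧
  (∀ z ∈ frontier G, ρ z = z) ∧
  ρ '' ((closure G)ᶜ) = G ∧ ρ '' G = (closure G)ᶜ

/-- `K` is the reproducing kernel of the Bergman space `B₂(G)`. -/
def IsBergmanKernel (G : Set ℂ) (K : ℂ → ℂ → ℂ) : Prop :=
  (∀ η ∈ G, MemB2 G (fun z => K z η)) ∧
  (∀ f : ℂ → ℂ, MemB2 G f → ∀ η ∈ G, f η = bInner G f (fun z => K z η))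

/-- A linear operator on functions which restricts to a bounded bijection of `B₂(G)`. -/
def IsBergmanAutomorphism (G : Set ℂ) (T : (ℂ → ℂ) →ₗ[ℂ] (ℂ → ℂ)) : Prop :=
  (∀ f, MemB2 G f → MemB2 G (T f)) ∧
  (∃ M > (0:ℝ), ∀ f, MemB2 G f →
    ∫ z in G, ‖T f z‖ ^ 2 ∂volume ≤ M * ∫ z in G, ‖f z‖ ^ 2 ∂volume) ∧
  Set.BijOn (fun f => T f) {f | MemB2 G f} {f | MemB2 G f}

/-- Self-adjointness with respect to the Bergman inner product. -/
def IsBergmanSelfAdjoint (G : Set ℂ) (T : (ℂ → ℂ) →ₗ[ℂ] (ℂ → ℂ)) : Prop :=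
  ∀ f g, MemB2 G f → MemB2 G g → bInner G (T f) g = bInner G f (T g)

lemma mv_circle {f : ℂ → ℂ} {c : ℂ} {r s : ℝ} (hf : DifferentiableOn ℂ f (Metric.ball c r))
    (h0 : 0 < s) (hs : s < r) :
    ENNReal.ofReal (2 * Real.pi) * ‖f c‖ₑ ^ 2 ≤
      ∫⁻ θ in Set.Ioo (-Real.pi) Real.pi, ‖f (circleMap c s θ)‖ₑ ^ 2 := by
  have hsub : Metric.closedBall c |s| ⊆ Metric.ball c r := by
    rw [abs_of_pos h0]; exact Metric.closedBall_subset_ball hs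
  have hd : DiffContOnCl ℂ (fun z => f z ^ 2) (Metric.ball c |s|) := by
    apply DifferentiableOn.diffContOnCl
    rw [closure_ball _ (by positivity)]
    exact (hf.mono hsub).pow 2
  have h1 := hd.circleAverage
  rw [Real.circleAverage_def] at h1
  have hper : Function.Periodic (fun θ => f (circleMap c s θ) ^ 2) (2 * Real.pi) := by
    intro θ; simp [periodic_circleMap c s θ]
  have h2 := hper.intervalIntegral_add_eq 0 (-Real.pi)
  rw [zero_add] at h2
  rw [h2, show -Real.pi + 2 * Real.pi = Real.pi by ring,
    intervalIntegral.integral_of_le (by linarith [Real.pi_pos]),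
    MeasureTheory.integral_Ioc_eq_integral_Ioo] at h1
  have h3 : ((2 * Real.pi : ℝ) : ℂ) * f c ^ 2 =
      ∫ θ in Set.Ioo (-Real.pi) Real.pi, f (circleMap c s θ) ^ 2 := by
    rw [← h1]
    have : (Real.pi : ℂ) ≠ 0 := by exact_mod_cast Real.pi_ne_zero
    rw [Complex.real_smul]
    push_cast
    field_simp
  calc ENNReal.ofReal (2 * Real.pi) * ‖f c‖ₑ ^ 2
      = ‖((2 * Real.pi : ℝ) : ℂ) * f c ^ 2‖ₑ := by
        rw [enorm_mul, enorm_pow]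
        congr 1
        rw [← ofReal_norm, Complex.norm_real, Real.norm_of_nonneg (by positivity)]
    _ ≤ _ := by
        rw [h3]
        refine (enorm_integral_le_lintegral_enorm _).trans (le_of_eq ?_)
        simp [enorm_pow]

lemma mv_ball {f : ℂ → ℂ} {c : ℂ} {r : ℝ} (hr : 0 < r)
    (hf : DifferentiableOn ℂ f (Metric.ball c r)) :
    ENNReal.ofReal (r / 2) * (ENNReal.ofReal (r / 2) * (ENNReal.ofReal (2 * Real.pi) * ‖f c‖ₑ ^ 2)) ≤
      ∫⁻ z in Metric.ball c r, ‖f z‖ₑ ^ 2 := by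
  set g : ℂ → ENNReal := (Metric.ball c r).indicator (fun z => ‖f z‖ₑ ^ 2) with hg
  have e1 : ∫⁻ z in Metric.ball c r, ‖f z‖ₑ ^ 2 = ∫⁻ z, g (c + z) := by
    rw [lintegral_add_left_eq_self g c, hg, lintegral_indicator Metric.isOpen_ball.measurableSet]
  rw [e1, ← Complex.lintegral_comp_polarCoord_symm]
  have hsub : Set.Ioo (r/2) r ×ˢ Set.Ioo (-Real.pi) Real.pi ⊆ polarCoord.target := by
    intro p hp
    simp only [polarCoord_target, Set.mem_prod, Set.mem_Ioo, Set.mem_Ioi] at hp ⊢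
    exact ⟨by linarith [hp.1.1], hp.2⟩
  refine le_trans ?_ (lintegral_mono_set hsub)
  have hmem : ∀ p ∈ Set.Ioo (r/2) r ×ˢ Set.Ioo (-Real.pi) Real.pi,
      circleMap c p.1 p.2 ∈ Metric.ball c r := by
    intro p hp
    simp only [Set.mem_prod, Set.mem_Ioo] at hp
    rw [Metric.mem_ball, dist_eq_norm, circleMap_sub_center, norm_circleMap_zero, abs_of_pos (by linarith)]
    exact hp.1.2
  have e2 : ∫⁻ p in Set.Ioo (r/2) r ×ˢ Set.Ioo (-Real.pi) Real.pi,
      ENNReal.ofReal (r/2) * ‖f (circleMap c p.1 p.2)‖ₑ ^ 2 ≤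
      ∫⁻ p in Set.Ioo (r/2) r ×ˢ Set.Ioo (-Real.pi) Real.pi,
        ENNReal.ofReal p.1 • g (c + Complex.polarCoord.symm p) := by
    refine setLIntegral_mono' (measurableSet_Ioo.prod measurableSet_Ioo) ?_
    intro p hp
    have hc : c + Complex.polarCoord.symm p = circleMap c p.1 p.2 := by
      rw [Complex.polarCoord_symm_apply, circleMap, Complex.exp_mul_I]
      push_cast; rfl
    rw [hc, hg, Set.indicator_of_mem (hmem p hp), smul_eq_mul]
    gcongr
    exact hp.1.1.le
  refine le_trans ?_ e2
  rw [Measure.volume_eq_prod, ← Measure.prod_restrict, lintegral_prod]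
  · calc _ = ∫⁻ s in Set.Ioo (r/2) r, (ENNReal.ofReal (r / 2) * (ENNReal.ofReal (2 * Real.pi) * ‖f c‖ₑ ^ 2)) := by
            rw [lintegral_const, mul_comm]
            rw [Measure.restrict_apply_univ, Real.volume_Ioo, show r - r / 2 = r / 2 by ring]
      _ ≤ _ := by
        refine setLIntegral_mono' measurableSet_Ioo ?_
        intro s hs
        rw [lintegral_const_mul' _ _ ENNReal.ofReal_ne_top]
        gcongr
        exact mv_circle hf (by linarith [hs.1]) hs.2
  · rw [Measure.prod_restrict, ← Measure.volume_eq_prod]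
    refine AEMeasurable.const_mul (AEMeasurable.pow_const (AEMeasurable.enorm ?_) _) _
    refine ContinuousOn.aemeasurable (hf.continuousOn.comp ?_ hmem) (measurableSet_Ioo.prod measurableSet_Ioo)
    refine Continuous.continuousOn ?_
    simp only [circleMap]; fun_prop

lemma vol_le (ρ : ℂ → ℂ) (K : NNReal) (h : LipschitzWith K ρ) (s : Set ℂ) :
    volume (ρ '' s) ≤ (K : ENNReal) ^ (2:ℝ) * volume s := by
  have h1 := h.hausdorffMeasure_image_le (d := 2) (by norm_num) s
  have : ((Measure.hausdorffMeasure (2:ℝ)) : Measure ℂ).IsAddHaarMeasure := by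
    have := MeasureTheory.isAddHaarMeasure_hausdorffMeasure (E := ℂ)
    simpa using this
  have h2 := Measure.isAddLeftInvariant_eq_smul (volume : Measure ℂ) (Measure.hausdorffMeasure (2:ℝ) : Measure ℂ)
  rw [h2, Measure.smul_apply, Measure.smul_apply, ENNReal.smul_def, ENNReal.smul_def, smul_eq_mul,
    smul_eq_mul, mul_left_comm]
  gcongr

lemma MemB2.memLp {G : Set ℂ} {f : ℂ → ℂ} (hG : IsOpen G) (hf : MemB2 G f) :
    MemLp f 2 (volume.restrict G) :=
  (memLp_two_iff_integrable_sq_norm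
    (hf.1.continuousOn.aestronglyMeasurable hG.measurableSet)).2 hf.2

lemma memB2_of_memLp {G : Set ℂ} {f : ℂ → ℂ} (hd : DifferentiableOn ℂ f G)
    (hf : MemLp f 2 (volume.restrict G)) : MemB2 G f :=
  ⟨hd, (memLp_two_iff_integrable_sq_norm hf.1).1 hf⟩

/-- The Bergman space as a submodule of functions. -/
noncomputable def bV (G : Set ℂ) (hG : IsOpen G) : Submodule ℂ (ℂ → ℂ) where
  carrier := {f | MemB2 G f}
  zero_mem' := memB2_of_memLp (differentiableOn_const 0) MemLp.zero
  add_mem' := fun ha hb => memB2_of_memLp (ha.1.add hb.1) ((ha.memLp hG).add (hb.memLp hG))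
  smul_mem' := fun c _ ha => memB2_of_memLp (ha.1.const_smul c) ((ha.memLp hG).const_smul c)

/-- The Bergman space as a submodule of `L²`. -/
noncomputable def bB (G : Set ℂ) (hG : IsOpen G) : Submodule ℂ (Lp ℂ 2 (volume.restrict G)) where
  carrier := {u | ∃ f, MemB2 G f ∧ u =ᵐ[volume.restrict G] f}
  zero_mem' := ⟨0, (bV G hG).zero_mem, Lp.coeFn_zero _ _ _⟩
  add_mem' := by
    rintro a b ⟨f, hf, hf'⟩ ⟨g, hg, hg'⟩
    exact ⟨f + g, (bV G hG).add_mem hf hg, (Lp.coeFn_add a b).trans (hf'.add hg')⟩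
  smul_mem' := by
    rintro c a ⟨f, hf, hf'⟩
    exact ⟨c • f, (bV G hG).smul_mem c hf, (Lp.coeFn_smul c a).trans (hf'.const_smul c)⟩

/-- Embedding of Bergman functions in `L²`. -/
noncomputable def toB {G : Set ℂ} (hG : IsOpen G) (f : ℂ → ℂ) (hf : MemB2 G f) : bB G hG :=
  ⟨(hf.memLp hG).toLp f, f, hf, MemLp.coeFn_toLp _⟩

lemma toB_congr {G : Set ℂ} (hG : IsOpen G) {f g : ℂ → ℂ} (hf : MemB2 G f) (hg : MemB2 G g)
    (h : ∀ z ∈ G, f z = g z) : toB hG f hf = toB hG g hg := by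
  apply Subtype.ext
  change (hf.memLp hG).toLp f = (hg.memLp hG).toLp g
  rw [MemLp.toLp_eq_toLp_iff]
  exact (ae_restrict_iff' hG.measurableSet).2 (Filter.Eventually.of_forall h)

lemma inner_toB {G : Set ℂ} (hG : IsOpen G) {f g : ℂ → ℂ} (hf : MemB2 G f) (hg : MemB2 G g) :
    inner ℂ (toB hG g hg) (toB hG f hf) = bInner G f g := by
  change inner ℂ ((hg.memLp hG).toLp g) ((hf.memLp hG).toLp f) = _
  rw [L2.inner_def, bInner]
  apply integral_congr_ae
  filter_upwards [(hg.memLp hG).coeFn_toLp, (hf.memLp hG).coeFn_toLp] with z h1 h2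
  rw [h1, h2]
  rfl

lemma norm_toB_sq {G : Set ℂ} (hG : IsOpen G) {f : ℂ → ℂ} (hf : MemB2 G f) :
    ‖toB hG f hf‖ ^ 2 = ∫ z in G, ‖f z‖ ^ 2 := by
  have h := inner_toB hG hf hf
  have hi := inner_self_eq_norm_sq_to_K (𝕜 := ℂ) (toB hG f hf)
  have h := hi.symm.trans h
  rw [bInner] at h
  have h2 : (∫ z in G, f z * (starRingEnd ℂ) (f z)) = ((∫ z in G, ‖f z‖ ^ 2 : ℝ) : ℂ) := by
    rw [← integral_complex_ofReal]
    congr 1; ext z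
    rw [Complex.mul_conj']; push_cast; rfl
  rw [h2] at h
  exact Complex.ofReal_injective ((Complex.ofReal_pow _ _).trans h)

lemma lintegral_toB {G : Set ℂ} (hG : IsOpen G) {f : ℂ → ℂ} (hf : MemB2 G f) :
    ∫⁻ z in G, ‖f z‖ₑ ^ 2 = ENNReal.ofReal (‖toB hG f hf‖ ^ 2) := by
  rw [norm_toB_sq, ofReal_integral_eq_lintegral_ofReal hf.2
    (Filter.Eventually.of_forall fun _ => by positivity)]
  congr 1; ext z
  rw [← ofReal_norm, ENNReal.ofReal_pow (norm_nonneg _)]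

lemma pt_bound {r : ℝ} (hr : 0 < r) : ∃ C : ℝ, 0 ≤ C ∧ ∀ (G : Set ℂ) (hG : IsOpen G) (f : ℂ → ℂ)
    (hf : MemB2 G f) (c : ℂ), Metric.ball c r ⊆ G → ‖f c‖ ≤ C * ‖toB hG f hf‖ := by
  have hD : 0 < (r / 2) * ((r / 2) * (2 * Real.pi)) := by positivity
  set D := (r / 2) * ((r / 2) * (2 * Real.pi)) with hDd
  refine ⟨Real.sqrt D⁻¹, by positivity, ?_⟩
  intro G hG f hf c hc
  have h1 := mv_ball hr (hf.1.mono hc)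
  have h2 := (h1.trans (lintegral_mono_set hc)).trans_eq (lintegral_toB hG hf)
  rw [← ofReal_norm, ← ENNReal.ofReal_pow (norm_nonneg _), ← ENNReal.ofReal_mul (by positivity),
    ← ENNReal.ofReal_mul (by positivity), ← ENNReal.ofReal_mul (by positivity),
    ENNReal.ofReal_le_ofReal_iff (by positivity)] at h2
  have h3 : D * ‖f c‖ ^ 2 ≤ ‖toB hG f hf‖ ^ 2 := by rw [hDd]; linarith
  have h4 : ‖f c‖ ^ 2 ≤ D⁻¹ * ‖toB hG f hf‖ ^ 2 := by
    rw [inv_mul_eq_div, le_div_iff₀ hD]; linarith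
  apply le_of_sq_le_sq _ (by positivity)
  rw [mul_pow, Real.sq_sqrt (by positivity)]
  exact h4


open Classical in
/-- The kernel vectors. -/
noncomputable def kv {G : Set ℂ} (hG : IsOpen G) {K : ℂ → ℂ → ℂ} (hK : IsBergmanKernel G K)
    (η : ℂ) : bB G hG :=
  if h : η ∈ G then toB hG (fun z => K z η) (hK.1 η h) else 0

lemma inner_kv {G : Set ℂ} (hG : IsOpen G) {K : ℂ → ℂ → ℂ} (hK : IsBergmanKernel G K)
    {η : ℂ} (hη : η ∈ G) {f : ℂ → ℂ} (hf : MemB2 G f) :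
    inner ℂ (kv hG hK η) (toB hG f hf) = f η := by
  rw [kv, dif_pos hη, inner_toB, ← hK.2 f hf η hη]

lemma kv_bound {G : Set ℂ} (hG : IsOpen G) {K : ℂ → ℂ → ℂ} (hK : IsBergmanKernel G K)
    {r : ℝ} (hr : 0 < r) : ∃ C : ℝ, 0 ≤ C ∧ ∀ c ∈ G, Metric.ball c r ⊆ G →
    ‖kv hG hK c‖ ≤ C := by
  obtain ⟨C, h0, hC⟩ := pt_bound hr
  refine ⟨C, h0, fun c hc hb => ?_⟩
  have h := hC G hG _ (hK.1 c hc) c hb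
  rw [← inner_kv hG hK hc (hK.1 c hc)] at h
  have e : toB hG (fun z => K z c) (hK.1 c hc) = kv hG hK c := by rw [kv, dif_pos hc]
  have hi := inner_self_eq_norm_sq_to_K (𝕜 := ℂ) (kv hG hK c)
  rw [e] at h
  replace h := (congrArg norm hi).symm.trans_le h
  simp only [norm_pow, RCLike.norm_ofReal, abs_norm] at h
  by_contra hlt
  push Not at hlt
  nlinarith [norm_nonneg (kv hG hK c)]

lemma closure_aux {G : Set ℂ} (hG : IsOpen G) {K : ℂ → ℂ → ℂ} (hK : IsBergmanKernel G K)
    (u : Lp ℂ 2 (volume.restrict G)) (v : ℕ → bB G hG)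
    (hv : Filter.Tendsto (fun n => (v n : Lp ℂ 2 (volume.restrict G))) Filter.atTop (nhds u)) :
    u ∈ bB G hG := by
  choose f hf hfv using fun n => (v n).2
  have hvf : ∀ n, v n = toB hG (f n) (hf n) := by
    intro n
    apply Subtype.ext
    apply Lp.ext
    exact (hfv n).trans (MemLp.coeFn_toLp ((hf n).memLp hG)).symm
  set F : ℂ → ℂ := fun z => inner ℂ (kv hG hK z : Lp ℂ 2 (volume.restrict G)) u with hF
  have hfe : ∀ n, ∀ z ∈ G, f n z = inner ℂ (kv hG hK z : Lp ℂ 2 (volume.restrict G)) (v n) := by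
    intro n z hz
    rw [← inner_kv hG hK hz (hf n), ← hvf n]; rfl
  have hloc : TendstoLocallyUniformlyOn f F Filter.atTop G := by
    rw [Metric.tendstoLocallyUniformlyOn_iff]
    intro ε hε x hx
    obtain ⟨r, hr, hb⟩ := Metric.isOpen_iff.1 hG x hx
    obtain ⟨C, hC0, hC⟩ := kv_bound hG hK (half_pos hr)
    refine ⟨Metric.ball x (r/2), mem_nhdsWithin_of_mem_nhds (Metric.ball_mem_nhds x (half_pos hr)), ?_⟩
    have h1 : ∀ᶠ n in Filter.atTop, dist (v n : Lp ℂ 2 (volume.restrict G)) u < ε / (C + 1) :=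
      Metric.tendsto_nhds.1 hv _ (by positivity)
    filter_upwards [h1] with n hn y hy
    have hyb : Metric.ball y (r/2) ⊆ G := by
      refine subset_trans (Metric.ball_subset_ball' ?_) hb
      have := Metric.mem_ball.1 hy
      linarith
    have hyG : y ∈ G := hyb (Metric.mem_ball_self (half_pos hr))
    rw [dist_comm, dist_eq_norm, hfe n y hyG, hF]
    simp only
    rw [← inner_sub_right]
    refine (norm_inner_le_norm _ _).trans_lt ?_
    rw [dist_eq_norm] at hn
    rw [lt_div_iff₀ (by positivity)] at hn
    have h5 : ‖(kv hG hK y : Lp ℂ 2 (volume.restrict G))‖ ≤ C := hC y hyG hyb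
    nlinarith [norm_nonneg ((v n : Lp ℂ 2 (volume.restrict G)) - u),
      norm_nonneg (kv hG hK y : Lp ℂ 2 (volume.restrict G))]
  have hd : DifferentiableOn ℂ F G :=
    hloc.differentiableOn (Filter.Eventually.of_forall fun n => (hf n).1) hG
  have hae : u =ᵐ[volume.restrict G] F := by
    obtain ⟨ns, hns, hsub⟩ := (tendstoInMeasure_of_tendsto_Lp hv).exists_seq_tendsto_ae
    have h2 : ∀ᵐ z ∂(volume.restrict G), ∀ n, (v n : Lp ℂ 2 (volume.restrict G)) z = f n z :=
      ae_all_iff.2 hfv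
    filter_upwards [hsub, h2, ae_restrict_mem hG.measurableSet] with z h3 h4 hz
    refine tendsto_nhds_unique h3 ?_
    simp only [h4]
    exact (hloc.tendsto_at hz).comp hns.tendsto_atTop
  exact ⟨F, memB2_of_memLp hd ((memLp_congr_ae hae).1 (Lp.memLp u)), hae⟩

lemma bB_closed {G : Set ℂ} (hG : IsOpen G) {K : ℂ → ℂ → ℂ} (hK : IsBergmanKernel G K)
    : IsClosed (bB G hG : Set (Lp ℂ 2 (volume.restrict G))) := by
  apply IsSeqClosed.isClosed
  intro v u hv hu
  exact closure_aux hG hK u (fun n => ⟨v n, hv n⟩) hu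

lemma bB_complete {G : Set ℂ} (hG : IsOpen G) {K : ℂ → ℂ → ℂ} (hK : IsBergmanKernel G K)
    : CompleteSpace (bB G hG) :=
  (bB_closed hG hK).completeSpace_coe

lemma ev_spec {G : Set ℂ} (hG : IsOpen G) {K : ℂ → ℂ → ℂ} (hK : IsBergmanKernel G K)
    (u : bB G hG) : ∃ h : MemB2 G (fun z => inner ℂ (kv hG hK z) u),
    toB hG _ h = u := by
  obtain ⟨f, hf, hu⟩ := u.2
  have e : u = toB hG f hf := by
    apply Subtype.ext
    apply Lp.ext
    exact hu.trans (MemLp.coeFn_toLp (hf.memLp hG)).symm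
  have h1 : ∀ z ∈ G, inner ℂ (kv hG hK z) u = f z := by
    intro z hz
    rw [e, inner_kv hG hK hz hf]
  have h2 : MemB2 G (fun z => inner ℂ (kv hG hK z) u) := by
    refine ⟨hf.1.congr h1, ?_⟩
    refine hf.2.congr_fun ?_ hG.measurableSet
    intro z hz
    simp only [h1 z hz]
  refine ⟨h2, ?_⟩
  conv_rhs => rw [e]
  exact toB_congr hG h2 hf h1


lemma op_exists {H E : Type*} [NormedAddCommGroup H] [InnerProductSpace ℂ H] [CompleteSpace H]
    [NormedAddCommGroup E] [InnerProductSpace ℂ E] [CompleteSpace E] (J : H →L[ℂ] E)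
    (c : ℝ) (hc : 0 < c) (hJ : ∀ u, ‖u‖ ^ 2 ≤ c * ‖J u‖ ^ 2) :
    ∃ R : H →L[ℂ] H, (∀ u v, inner ℂ (R u) v = inner ℂ u (R v)) ∧ Function.Bijective R ∧
      ∀ u v, inner ℂ (J (R u)) (J (R v)) = inner ℂ u v := by
  set S : H →L[ℂ] H := (ContinuousLinearMap.adjoint J) ∘L J with hS
  have hpos : 0 ≤ S := by
    rw [ContinuousLinearMap.nonneg_iff_isPositive]
    exact ContinuousLinearMap.isPositive_adjoint_comp_self J
  have hin : ∀ u v, inner ℂ (S u) v = inner ℂ (J u) (J v) := by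
    intro u v
    rw [hS, ContinuousLinearMap.comp_apply, ContinuousLinearMap.adjoint_inner_left]
  have hunit : IsUnit S := by
    refine ContinuousLinearMap.isUnit_of_forall_le_norm_inner_map S
      (c := ⟨c⁻¹, by positivity⟩) (by exact_mod_cast inv_pos.2 hc) ?_
    intro x
    rw [hin, inner_self_eq_norm_sq_to_K]
    simp only [norm_pow, RCLike.norm_ofReal, abs_norm]
    have := hJ x
    rw [mul_comm]
    change c⁻¹ * ‖x‖ ^ 2 ≤ _
    rw [inv_mul_le_iff₀ hc]
    exact this
  set T := CFC.sqrt S with hT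
  have hTT : T * T = S := CFC.sqrt_mul_sqrt_self S hpos
  have hTu : IsUnit T := (CFC.isUnit_sqrt_iff S hpos).2 hunit
  have hTs : IsSelfAdjoint T := (CFC.sqrt_nonneg S).isSelfAdjoint
  obtain ⟨t, ht⟩ := hTu
  set R : H →L[ℂ] H := ((t⁻¹ : (H →L[ℂ] H)ˣ) : H →L[ℂ] H) with hR
  have hRT : R * T = 1 := by rw [hR, ← ht]; simp
  have hTR : T * R = 1 := by rw [hR, ← ht]; simp
  have a1 : ∀ u, R (T u) = u := fun u => DFunLike.congr_fun hRT u
  have a2 : ∀ u, T (R u) = u := fun u => DFunLike.congr_fun hTR u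
  have hTi : ∀ u v, inner ℂ (T u) v = inner ℂ u (T v) := by
    intro u v
    exact hTs.isSymmetric u v
  refine ⟨R, ?_, ⟨Function.LeftInverse.injective (g := T) a2, Function.RightInverse.surjective (g := T) a1⟩, ?_⟩
  · intro u v
    conv_lhs => rw [← a2 v, ← hTi, a2]
  · intro u v
    have : S (R u) = T u := by
      rw [← hTT]; change T (T (R u)) = T u; rw [a2]
    rw [← hin, this, hTi, a2]

lemma norm_sq_toLp {ν : Measure ℂ} {f : ℂ → ℂ} (hf : MemLp f 2 ν) :
    ‖hf.toLp f‖ ^ 2 = ∫ z, ‖f z‖ ^ 2 ∂ν := by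
  have h := inner_self_eq_norm_sq_to_K (𝕜 := ℂ) (hf.toLp f)
  rw [L2.inner_def] at h
  have h2 : (∫ z, inner ℂ (hf.toLp f z) (hf.toLp f z) ∂ν) = ((∫ z, ‖f z‖ ^ 2 ∂ν : ℝ) : ℂ) := by
    rw [← integral_complex_ofReal]
    apply integral_congr_ae
    filter_upwards [hf.coeFn_toLp] with z hz
    rw [hz, inner_self_eq_norm_sq_to_K]
    push_cast; rfl
  rw [h2] at h
  exact (Complex.ofReal_injective (h.trans (Complex.ofReal_pow _ _).symm)).symm

lemma int_le {μ ν : Measure ℂ} {C : NNReal} (h : ν ≤ (C : ENNReal) • μ) {f : ℂ → ℂ}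
    (hf : MemLp f 2 μ) : ∫ z, ‖f z‖ ^ 2 ∂ν ≤ C * ∫ z, ‖f z‖ ^ 2 ∂μ := by
  have hi := (memLp_two_iff_integrable_sq_norm hf.1).1 hf
  have := integral_mono_measure h (Filter.Eventually.of_forall fun z => by positivity)
    (hi.smul_measure (c := (C : ENNReal)) ENNReal.coe_ne_top)
  rw [integral_smul_measure] at this
  simpa using this

lemma J_exists {G : Set ℂ} (hG : IsOpen G) {K : ℂ → ℂ → ℂ} (hK : IsBergmanKernel G K)
    {ν : Measure ℂ} {C C' : NNReal} (h : ν ≤ (C : ENNReal) • volume.restrict G)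
    (h' : volume.restrict G ≤ (C' : ENNReal) • ν) :
    ∃ J : bB G hG →L[ℂ] Lp ℂ 2 ν, (∀ u, J u =ᵐ[ν] fun z => inner ℂ (kv hG hK z) u) ∧
      ∀ u, ‖u‖ ^ 2 ≤ (C' : ℝ) * ‖J u‖ ^ 2 := by
  have hm : ∀ u : bB G hG, MemLp (fun z => inner ℂ (kv hG hK z) u) 2 ν := fun u =>
    ((ev_spec hG hK u).1.memLp hG).of_measure_le_smul ENNReal.coe_ne_top h
  have hn : ∀ u : bB G hG, ‖u‖ ^ 2 = ∫ z in G, ‖inner ℂ (kv hG hK z) u‖ ^ 2 := by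
    intro u
    obtain ⟨h1, h2⟩ := ev_spec hG hK u
    have := norm_toB_sq hG h1
    rwa [h2] at this
  let J0 : bB G hG →ₗ[ℂ] Lp ℂ 2 ν :=
    { toFun := fun u => (hm u).toLp _
      map_add' := by
        intro u v
        rw [← MemLp.toLp_add, MemLp.toLp_eq_toLp_iff]
        refine Filter.Eventually.of_forall fun z => ?_
        simp only [Pi.add_apply]
        exact inner_add_right _ _ _
      map_smul' := by
        intro c u
        rw [RingHom.id_apply, ← MemLp.toLp_const_smul, MemLp.toLp_eq_toLp_iff]
        refine Filter.Eventually.of_forall fun z => ?_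
        simp only [Pi.smul_apply]
        exact inner_smul_right _ _ _ }
  have hJ0 : ∀ u, ‖J0 u‖ ^ 2 = ∫ z, ‖inner ℂ (kv hG hK z) u‖ ^ 2 ∂ν := fun u => norm_sq_toLp (hm u)
  refine ⟨J0.mkContinuous (Real.sqrt C) ?_, ?_, ?_⟩
  · intro u
    apply le_of_sq_le_sq _ (by positivity)
    rw [mul_pow, Real.sq_sqrt (by positivity), hJ0, hn]
    exact int_le h ((ev_spec hG hK u).1.memLp hG)
  · intro u
    exact (hm u).coeFn_toLp
  · intro u
    rw [LinearMap.mkContinuous_apply, hJ0, hn]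
    exact int_le h' (hm u)

lemma nu_facts {G : Set ℂ} {ρ : ℂ → ℂ} {C₁ C₂ : ℝ} (hGo : IsOpen G)
    (hbij : Function.Bijective ρ) (hC₁ : 0 < C₁) (hC₂ : 0 < C₂)
    (hL : ∀ z₁ z₂ : ℂ,
      C₁ * ‖z₁ - z₂‖ ≤ ‖ρ z₁ - ρ z₂‖ ∧ ‖ρ z₁ - ρ z₂‖ ≤ C₂ * ‖z₁ - z₂‖)
    (hρ1 : ρ '' ((closure G)ᶜ) = G) :
    ∃ ν : Measure ℂ, ν = (volume.restrict (closure G)ᶜ).map ρ ∧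
      (∃ C : NNReal, ν ≤ (C : ENNReal) • volume.restrict G) ∧
      (∃ C : NNReal, 0 < C ∧ volume.restrict G ≤ (C : ENNReal) • ν) ∧ (∀ᵐ w ∂ν, w ∈ G) := by
  have hlip : LipschitzWith C₂.toNNReal ρ := LipschitzWith.of_dist_le' fun x y => by
    rw [dist_eq_norm, dist_eq_norm]; exact (hL x y).2
  obtain ⟨g, hg1, hg2⟩ := Function.bijective_iff_has_inverse.1 hbij
  have hglip : LipschitzWith C₁⁻¹.toNNReal g := LipschitzWith.of_dist_le' fun x y => by
    rw [dist_eq_norm, dist_eq_norm]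
    change _ ≤ C₁⁻¹ * _
    have := (hL (g x) (g y)).1
    rw [hg2, hg2] at this
    rwa [le_inv_mul_iff₀ hC₁]
  have hm : Measurable ρ := hlip.continuous.measurable
  have hΩ : MeasurableSet (closure G)ᶜ := isClosed_closure.measurableSet.compl
  have hmap : ∀ s, MeasurableSet s →
      (volume.restrict (closure G)ᶜ).map ρ s = volume (ρ ⁻¹' s ∩ (closure G)ᶜ) := by
    intro s hs
    rw [Measure.map_apply hm hs, Measure.restrict_apply (hm hs)]
  refine ⟨_, rfl, ⟨C₁⁻¹.toNNReal ^ 2, ?_⟩,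
    ⟨C₂.toNNReal ^ 2, pow_pos (Real.toNNReal_pos.2 hC₂) 2, ?_⟩, ?_⟩
  · rw [Measure.le_iff]
    intro s hs
    rw [hmap s hs, Measure.smul_apply, Measure.restrict_apply hs, smul_eq_mul]
    have h := vol_le g _ hglip (s ∩ G)
    rw [ENNReal.rpow_ofNat] at h
    rw [ENNReal.coe_pow]
    refine le_trans (measure_mono ?_) h
    rintro x ⟨hx1, hx2⟩
    exact ⟨ρ x, ⟨hx1, hρ1 ▸ Set.mem_image_of_mem ρ hx2⟩, hg1 x⟩
  · rw [Measure.le_iff]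
    intro s hs
    rw [Measure.smul_apply, hmap s hs, Measure.restrict_apply hs, smul_eq_mul]
    have h := vol_le ρ _ hlip (ρ ⁻¹' s ∩ (closure G)ᶜ)
    rw [ENNReal.rpow_ofNat] at h
    rw [ENNReal.coe_pow]
    refine le_trans (measure_mono ?_) h
    rintro x ⟨hx1, hx2⟩
    rw [← hρ1] at hx2
    obtain ⟨y, hy, rfl⟩ := hx2
    exact ⟨y, ⟨hx1, hy⟩, rfl⟩
  · refine (ae_map_iff (p := fun w => w ∈ G) hm.aemeasurable hGo.measurableSet).2 ?_
    filter_upwards [ae_restrict_mem hΩ] with x hx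
    rw [← hρ1]
    exact Set.mem_image_of_mem ρ hx

lemma lift_op {G : Set ℂ} (hG : IsOpen G) {K : ℂ → ℂ → ℂ} (hK : IsBergmanKernel G K)
    (R : bB G hG →L[ℂ] bB G hG) :
    ∃ T : (ℂ → ℂ) →ₗ[ℂ] (ℂ → ℂ),
      (∀ f (hf : MemB2 G f), ∀ z ∈ G, T f z = inner ℂ (kv hG hK z) (R (toB hG f hf))) ∧
      (∀ f, MemB2 G f → ∀ z, z ∉ G → T f z = f z) := by
  classical
  let B0 : bV G hG →ₗ[ℂ] bB G hG :=
    { toFun := fun f => toB hG f.1 f.2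
      map_add' := fun f g => rfl
      map_smul' := fun c f => rfl }
  let T0 : bV G hG →ₗ[ℂ] (ℂ → ℂ) :=
    { toFun := fun f z => if z ∈ G then inner ℂ (kv hG hK z) (R (B0 f)) else f.1 z
      map_add' := by
        intro f g
        ext z
        by_cases hz : z ∈ G
        · simp only [if_pos hz, Pi.add_apply, map_add]
          exact inner_add_right (𝕜 := ℂ) (kv hG hK z) (R (B0 f)) (R (B0 g))
        · simp [hz]
      map_smul' := by
        intro c f
        ext z
        by_cases hz : z ∈ G
        · simp only [if_pos hz, Pi.smul_apply, map_smul, RingHom.id_apply]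
          exact inner_smul_right (𝕜 := ℂ) (kv hG hK z) (R (B0 f)) c
        · simp [hz] }
  obtain ⟨T, hT⟩ := T0.exists_extend
  have hT' : ∀ f (hf : MemB2 G f), T f = T0 ⟨f, hf⟩ := fun f hf =>
    DFunLike.congr_fun hT ⟨f, hf⟩
  refine ⟨T, ?_, ?_⟩
  · intro f hf z hz
    rw [hT' f hf]
    exact if_pos hz
  · intro f hf z hz
    rw [hT' f hf]
    exact if_neg hz

theorem reflected_kernels_orthosimilar
    (G : Set ℂ) (hG : IsUnboundedQuasidisk G)
    (ρ : ℂ → ℂ) (hρ : IsAhlforsReflection G ρ)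
    (K : ℂ → ℂ → ℂ) (hK : IsBergmanKernel G K) :
    ∃ R : (ℂ → ℂ) →ₗ[ℂ] (ℂ → ℂ),
      IsBergmanAutomorphism G R ∧ IsBergmanSelfAdjoint G R ∧
      ∀ f : ℂ → ℂ, MemB2 G f → ∀ z ∈ G,
        f z = ∫ ξ in (closure G)ᶜ,
          bInner G f (R (fun τ => K τ (ρ ξ))) * (R (fun τ => K τ (ρ ξ))) z ∂volume := by
  have hGo : IsOpen G := hG.1
  obtain ⟨hbij, ⟨C₁, hC₁, C₂, hC₂, hL⟩, -, hρ1, -⟩ := hρ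
  have hlip : LipschitzWith ⟨C₂, hC₂.le⟩ ρ := LipschitzWith.of_dist_le_mul fun x y => by
    rw [dist_eq_norm, dist_eq_norm]; exact (hL x y).2
  obtain ⟨ν, hν, hν1, hν2, hν3⟩ : ∃ ν : Measure ℂ, ν = (volume.restrict (closure G)ᶜ).map ρ ∧
      (∃ C : NNReal, ν ≤ (C : ENNReal) • volume.restrict G) ∧
      (∃ C : NNReal, 0 < C ∧ volume.restrict G ≤ (C : ENNReal) • ν) ∧ (∀ᵐ w ∂ν, w ∈ G) :=
    nu_facts hGo hbij hC₁ hC₂ hL hρ1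
  obtain ⟨C, hC⟩ := hν1
  obtain ⟨C', hC'0, hC'⟩ := hν2
  have hcomp : CompleteSpace (bB G hGo) := bB_complete hGo hK
  obtain ⟨J, hJ, hJn⟩ := J_exists hGo hK hC hC'
  obtain ⟨R, hRs, hRb, hRJ⟩ := op_exists J C' (by exact_mod_cast hC'0) hJn
  obtain ⟨T, hT1, hT2⟩ := lift_op hGo hK R
  have hMT : ∀ f (hf : MemB2 G f), ∃ h : MemB2 G (T f), toB hGo (T f) h = R (toB hGo f hf) := by
    intro f hf
    obtain ⟨h1, h2⟩ := ev_spec hGo hK (R (toB hGo f hf))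
    have h3 : MemB2 G (T f) := by
      refine ⟨h1.1.congr (hT1 f hf), h1.2.congr_fun ?_ hGo.measurableSet⟩
      intro z hz
      simp only [hT1 f hf z hz]
    refine ⟨h3, ?_⟩
    rw [toB_congr hGo h3 h1 (hT1 f hf), h2]
  have hRinj := hRb.1
  refine ⟨T, ⟨fun f hf => (hMT f hf).1, ?_, fun f hf => (hMT f hf).1, ?_, ?_⟩, ?_, ?_⟩
  · refine ⟨‖R‖ ^ 2 + 1, by positivity, fun f hf => ?_⟩
    obtain ⟨h1, h2⟩ := hMT f hf
    rw [← norm_toB_sq hGo h1, ← norm_toB_sq hGo hf, h2]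
    have := R.le_opNorm (toB hGo f hf)
    calc _ ≤ (‖R‖ * ‖toB hGo f hf‖) ^ 2 := by gcongr
      _ ≤ _ := by rw [mul_pow]; gcongr; linarith
  · intro f hf g hg hfg
    simp only at hfg
    have hf : MemB2 G f := hf
    have hg : MemB2 G g := hg
    obtain ⟨h1, h2⟩ := hMT f hf
    obtain ⟨h3, h4⟩ := hMT g hg
    have e : toB hGo f hf = toB hGo g hg := by
      apply hRinj
      rw [← h2, ← h4]
      exact toB_congr hGo h1 h3 fun z _ => by rw [hfg]
    ext z
    by_cases hz : z ∈ G
    · rw [← inner_kv hGo hK hz hf, e, inner_kv hGo hK hz hg]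
    · rw [← hT2 f hf z hz, ← hT2 g hg z hz, hfg]
  · intro g hg
    have hg : MemB2 G g := hg
    obtain ⟨u, hu⟩ := hRb.2 (toB hGo g hg)
    obtain ⟨h1, h2⟩ := ev_spec hGo hK u
    classical
    set f : ℂ → ℂ := fun z => if z ∈ G then inner ℂ (kv hGo hK z) u else g z with hfd
    have hfe : ∀ z ∈ G, f z = inner ℂ (kv hGo hK z) u := fun z hz => if_pos hz
    have hf : MemB2 G f := by
      refine ⟨h1.1.congr hfe, h1.2.congr_fun ?_ hGo.measurableSet⟩
      intro z hz
      simp only [hfe z hz]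
    have hfu : toB hGo f hf = u := by rw [toB_congr hGo hf h1 hfe, h2]
    refine ⟨f, hf, ?_⟩
    ext z
    by_cases hz : z ∈ G
    · simp only
      rw [hT1 f hf z hz, hfu, hu, inner_kv hGo hK hz hg]
    · simp only
      rw [hT2 f hf z hz, hfd]
      simp only [if_neg hz]
  · intro f g hf hg
    obtain ⟨h1, h2⟩ := hMT f hf
    obtain ⟨h3, h4⟩ := hMT g hg
    rw [← inner_toB hGo h1 hg, ← inner_toB hGo hf h3, h2, h4, hRs]
  · intro f hf z hz
    have hme : MeasurableEmbedding ρ := hlip.continuous.measurableEmbedding hbij.1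
    have e1 := hme.integral_map (μ := volume.restrict (closure G)ᶜ) (fun w =>
      bInner G f (T (fun τ => K τ w)) * (T (fun τ => K τ w)) z)
    rw [← e1, ← hν]
    set u := toB hGo f hf with hu
    have e2 : ∫ w, bInner G f (T (fun τ => K τ w)) * (T (fun τ => K τ w)) z ∂ν =
        inner ℂ (J (R (kv hGo hK z))) (J (R u)) := by
      rw [L2.inner_def]
      apply integral_congr_ae
      filter_upwards [hν3, hJ (R (kv hGo hK z)), hJ (R u)] with w hw h1 h2
      have hkw : toB hGo (fun τ => K τ w) (hK.1 w hw) = kv hGo hK w := by rw [kv, dif_pos hw]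
      obtain ⟨h3, h4⟩ := hMT _ (hK.1 w hw)
      rw [h1, h2, ← inner_toB hGo hf h3, h4, hT1 _ (hK.1 w hw) z hz, hkw, hRs, ← hRs, ← hRs]
      rw [RCLike.inner_apply]
      congr 1
      exact (inner_conj_symm (𝕜 := ℂ) (R (kv hGo hK z)) (kv hGo hK w)).symm
    rw [e2, hRJ, hu, inner_kv hGo hK hz hf]
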